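/- arXiv:1902.00955 — 2 statements merged into one kernel-verified Lean document; each statement's English description precedes it below -/
import Mathlib

section
/- Fix β > 0 and h ∈ ℝ. For every q > 0, the function q ↦ ∫_ℝ log cosh(h + β√q x) dγ(x) is differentiable at q with derivative (β²/2)·(1 − ∫_ℝ tanh²(h + β√q x) dγ(x)). -/
open Real MeasureTheory ProbabilityTheory

lemma Real.hasDerivAt_tanh (x : ℝ) : HasDerivAt Real.tanh (1 - Real.tanh x ^ 2) x := by
  have hc := (Real.cosh_pos x).ne'
  have h1 := (Real.hasDerivAt_sinh x).div (Real.hasDerivAt_cosh x) hc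
  have h2 : Real.tanh = Real.sinh / Real.cosh := by
    ext y
    exact Real.tanh_eq_sinh_div_cosh y
  rw [← h2] at h1
  refine h1.congr_deriv ?_
  rw [Real.tanh_eq_sinh_div_cosh]
  field_simp

lemma Real.hasDerivAt_log_cosh (x : ℝ) :
    HasDerivAt (fun y => Real.log (Real.cosh y)) (Real.tanh x) x := by
  rw [Real.tanh_eq_sinh_div_cosh]
  exact (Real.hasDerivAt_cosh x).log (Real.cosh_pos x).ne'

lemma Real.continuous_tanh : Continuous Real.tanh :=
  continuous_iff_continuousAt.2 fun x => (Real.hasDerivAt_tanh x).continuousAt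

lemma Real.continuous_log_cosh : Continuous fun x => Real.log (Real.cosh x) :=
  continuous_iff_continuousAt.2 fun x => (Real.hasDerivAt_log_cosh x).continuousAt

lemma Real.abs_log_cosh_le (x : ℝ) : |Real.log (Real.cosh x)| ≤ |x| := by
  rw [abs_of_nonneg (Real.log_nonneg (Real.one_le_cosh x)),
    Real.log_le_iff_le_exp (Real.cosh_pos x), ← Real.cosh_abs, Real.cosh_eq]
  have : Real.exp (-|x|) ≤ Real.exp |x| := Real.exp_le_exp.2 (by linarith [abs_nonneg x])
  linarith

lemma ProbabilityTheory.hasDerivAt_gaussianPDFReal (μ : ℝ) (v : NNReal) (x : ℝ) :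
    HasDerivAt (gaussianPDFReal μ v) (-((x - μ) / v) * gaussianPDFReal μ v x) x := by
  have h1 : HasDerivAt (fun y : ℝ => -(y - μ) ^ 2 / (2 * v)) (-(2 * (x - μ)) / (2 * v)) x := by
    simpa using ((((hasDerivAt_id x).sub_const μ).pow 2).neg).div_const (2 * (v : ℝ))
  have h2 := h1.exp.const_mul (√(2 * π * v))⁻¹
  rw [gaussianPDFReal_def]
  refine h2.congr_deriv ?_
  rw [neg_div _ (2 * (x - μ)), mul_div_mul_left _ _ two_ne_zero]
  ring

lemma ProbabilityTheory.integrable_gaussianReal_iff {μ : ℝ} {v : NNReal} (hv : v ≠ 0)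
    {f : ℝ → ℝ} :
    Integrable f (gaussianReal μ v) ↔ Integrable fun x => f x * gaussianPDFReal μ v x := by
  rw [gaussianReal_of_var_ne_zero μ hv,
    integrable_withDensity_iff (measurable_gaussianPDF μ v) (ae_of_all _ fun _ => gaussianPDF_lt_top)]
  simp only [toReal_gaussianPDF]

/-- **Stein's lemma**: Gaussian integration by parts. -/
lemma ProbabilityTheory.integral_sub_mean_mul_gaussianReal {μ : ℝ} {v : NNReal} (hv : v ≠ 0)
    {f f' : ℝ → ℝ} (hderiv : ∀ x, HasDerivAt f (f' x) x)
    (hf : Integrable f (gaussianReal μ v)) (hf' : Integrable f' (gaussianReal μ v))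
    (hxf : Integrable (fun x => (x - μ) * f x) (gaussianReal μ v)) :
    ∫ x, (x - μ) * f x ∂gaussianReal μ v = v * ∫ x, f' x ∂gaussianReal μ v := by
  have hv' : (v : ℝ) ≠ 0 := by exact_mod_cast hv
  rw [integrable_gaussianReal_iff hv] at hf hf' hxf
  have key := integral_mul_deriv_eq_deriv_mul_of_integrable (u := f) (u' := f')
    (fun x _ => hderiv x) (fun x _ => hasDerivAt_gaussianPDFReal μ v x)
    ((hxf.const_mul (-(v : ℝ)⁻¹)).congr (ae_of_all _ fun x => by
      simp only [Pi.mul_apply]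
      ring)) hf' hf
  rw [integral_gaussianReal_eq_integral_smul hv, integral_gaussianReal_eq_integral_smul hv]
  simp only [smul_eq_mul]
  calc ∫ x, gaussianPDFReal μ v x * ((x - μ) * f x)
      = ∫ x, -(v : ℝ) * (f x * (-((x - μ) / v) * gaussianPDFReal μ v x)) := by
        congr with x
        field_simp
    _ = v * ∫ x, gaussianPDFReal μ v x * f' x := by
        rw [integral_const_mul, key, neg_mul_neg]
        simp only [mul_comm]

lemma integrable_tanh_comp_gaussianReal (a b : ℝ) :
    Integrable (fun x => Real.tanh (a + b * x)) (gaussianReal 0 1) :=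
  (integrable_const (1 : ℝ)).mono'
    (Real.continuous_tanh.comp (by fun_prop)).aestronglyMeasurable
    (ae_of_all _ fun _ => (Real.abs_tanh_lt_one _).le)

lemma integrable_tanh_sq_comp_gaussianReal (a b : ℝ) :
    Integrable (fun x => Real.tanh (a + b * x) ^ 2) (gaussianReal 0 1) := by
  refine (integrable_const (1 : ℝ)).mono'
    ((Real.continuous_tanh.comp (by fun_prop)).pow 2).aestronglyMeasurable
    (ae_of_all _ fun x => ?_)
  rw [Real.norm_of_nonneg (sq_nonneg _)]
  exact (Real.tanh_sq_lt_one _).le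

lemma integrable_id_gaussianReal (μ : ℝ) (v : NNReal) :
    Integrable (fun x : ℝ => x) (gaussianReal μ v) :=
  (memLp_id_gaussianReal 1).integrable (by norm_num)

lemma integrable_mul_tanh_comp_gaussianReal (a b : ℝ) :
    Integrable (fun x => x * Real.tanh (a + b * x)) (gaussianReal 0 1) := by
  refine (integrable_id_gaussianReal 0 1).abs.mono'
    (continuous_id.mul (Real.continuous_tanh.comp (by fun_prop))).aestronglyMeasurable
    (ae_of_all _ fun x => ?_)
  rw [Real.norm_eq_abs, abs_mul]
  exact mul_le_of_le_one_right (abs_nonneg _) (Real.abs_tanh_lt_one _).le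

lemma integrable_log_cosh_comp_gaussianReal (a b : ℝ) :
    Integrable (fun x => Real.log (Real.cosh (a + b * x))) (gaussianReal 0 1) :=
  ((integrable_const a).add ((integrable_id_gaussianReal 0 1).const_mul b)).abs.mono'
    (Real.continuous_log_cosh.comp (by fun_prop)).aestronglyMeasurable
    (ae_of_all _ fun _ => Real.abs_log_cosh_le _)

lemma integral_mul_tanh_comp_gaussianReal (a b : ℝ) :
    ∫ x, x * Real.tanh (a + b * x) ∂gaussianReal 0 1 =
      b * (1 - ∫ x, Real.tanh (a + b * x) ^ 2 ∂gaussianReal 0 1) := by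
  have hderiv (x : ℝ) : HasDerivAt (fun y => Real.tanh (a + b * y))
      ((1 - Real.tanh (a + b * x) ^ 2) * b) x :=
    (Real.hasDerivAt_tanh _).comp x (by simpa using ((hasDerivAt_id x).const_mul b).const_add a)
  have hint := (integrable_const (1 : ℝ)).sub (integrable_tanh_sq_comp_gaussianReal a b)
  have stein := integral_sub_mean_mul_gaussianReal one_ne_zero hderiv
    (integrable_tanh_comp_gaussianReal a b) (hint.mul_const b)
    (by simpa using integrable_mul_tanh_comp_gaussianReal a b)
  simp only [sub_zero, NNReal.coe_one, one_mul] at stein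
  rw [stein, integral_mul_const, integral_sub (integrable_const _)
    (integrable_tanh_sq_comp_gaussianReal a b), mul_comm]
  simp

lemma hasDerivAt_integral_log_cosh_gaussianReal (a b : ℝ) :
    HasDerivAt (fun c => ∫ x, Real.log (Real.cosh (a + c * x)) ∂gaussianReal 0 1)
      (∫ x, x * Real.tanh (a + b * x) ∂gaussianReal 0 1) b := by
  refine (hasDerivAt_integral_of_dominated_loc_of_deriv_le (s := Set.univ)
    (F' := fun c x => x * Real.tanh (a + c * x)) (bound := fun x => |x|) Filter.univ_mem
    (.of_forall fun c => (integrable_log_cosh_comp_gaussianReal a c).aestronglyMeasurable)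
    (integrable_log_cosh_comp_gaussianReal a b)
    (integrable_mul_tanh_comp_gaussianReal a b).aestronglyMeasurable
    (ae_of_all _ fun x c _ => ?_) (integrable_id_gaussianReal 0 1).abs
    (ae_of_all _ fun x c _ => ?_)).2
  · rw [Real.norm_eq_abs, abs_mul]
    exact mul_le_of_le_one_right (abs_nonneg _) (Real.abs_tanh_lt_one _).le
  · rw [mul_comm]
    exact (Real.hasDerivAt_log_cosh _).comp c
      (by simpa using ((hasDerivAt_id c).mul_const x).const_add a)

/-- Differentiability of `q ↦ ∫ log cosh(h + β√q x) dγ(x)` for `q > 0`, with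
derivative `(β²/2)(1 − ∫ tanh²(h + β√q x) dγ(x))`. -/
theorem deriv_log_cosh_gaussian (β : ℝ) (hβ : 0 < β) (h : ℝ) (q : ℝ) (hq : 0 < q) :
    HasDerivAt
      (fun r : ℝ => ∫ x : ℝ, Real.log (Real.cosh (h + β * Real.sqrt r * x))
        ∂(gaussianReal 0 1))
      (β ^ 2 / 2 *
        (1 - ∫ x : ℝ, Real.tanh (h + β * Real.sqrt q * x) ^ 2 ∂(gaussianReal 0 1)))
      q := by
  have hsqrt : √q ≠ 0 := (Real.sqrt_pos.2 hq).ne'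
  have key := (hasDerivAt_integral_log_cosh_gaussianReal h (β * √q)).comp q
    ((Real.hasDerivAt_sqrt hq.ne').const_mul β)
  rw [integral_mul_tanh_comp_gaussianReal] at key
  refine key.congr_deriv ?_
  field_simp
end

section
/- Let (Ω,μ) be a probability space and Y : Ω → ℝ a bounded measurable function. Then the map t ↦ t · log ∫_Ω e^{Y(ω)/t} dμ(ω) is convex on (0,∞). (Applied with Y = the log-partition function, this shows that for any Hamiltonian and any α the 1RSB Legendre functional, viewed as a function of the reciprocal parameters t = 1/m, is convex.) -/
open Real MeasureTheory

/-- **Hölder's inequality** in logarithmic form: the functional `f ↦ log ∫ e^f dμ` is convex. -/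
theorem log_integral_exp_add_le {Ω : Type*} [MeasurableSpace Ω] {μ : Measure Ω} [NeZero μ]
    {f g : Ω → ℝ} (hf : Integrable (fun ω => exp (f ω)) μ)
    (hg : Integrable (fun ω => exp (g ω)) μ) {p q : ℝ} (hp : 0 ≤ p) (hq : 0 ≤ q)
    (hpq : p + q = 1) (hfg : Integrable (fun ω => exp (p * f ω + q * g ω)) μ) :
    log (∫ ω, exp (p * f ω + q * g ω) ∂μ)
      ≤ p * log (∫ ω, exp (f ω) ∂μ) + q * log (∫ ω, exp (g ω) ∂μ) := by
  have hA : 0 < ∫ ω, exp (f ω) ∂μ := integral_exp_pos hf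
  have hB : 0 < ∫ ω, exp (g ω) ∂μ := integral_exp_pos hg
  set A := ∫ ω, exp (f ω) ∂μ
  set B := ∫ ω, exp (g ω) ∂μ
  set S := p * log A + q * log B
  have pointwise (ω : Ω) :
      exp (p * f ω + q * g ω) ≤ exp S * (p / A * exp (f ω) + q / B * exp (g ω)) := by
    have h := convexOn_exp.2 (Set.mem_univ (f ω - log A)) (Set.mem_univ (g ω - log B)) hp hq hpq
    simp only [smul_eq_mul, exp_sub, exp_log hA, exp_log hB] at h
    calc exp (p * f ω + q * g ω)
        = exp S * exp (p * (f ω - log A) + q * (g ω - log B)) := by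
          rw [← exp_add]; congr 1; ring
      _ ≤ exp S * (p * (exp (f ω) / A) + q * (exp (g ω) / B)) := by gcongr
      _ = _ := by ring
  rw [log_le_iff_le_exp (integral_exp_pos hfg)]
  calc ∫ ω, exp (p * f ω + q * g ω) ∂μ
      ≤ ∫ ω, exp S * (p / A * exp (f ω) + q / B * exp (g ω)) ∂μ :=
        integral_mono hfg (((hf.const_mul _).add (hg.const_mul _)).const_mul _) pointwise
    _ = exp S * (p / A * A + q / B * B) := by
        rw [integral_const_mul, integral_add (hf.const_mul _) (hg.const_mul _),
          integral_const_mul, integral_const_mul]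
    _ = exp S := by
        rw [div_mul_cancel₀ _ hA.ne', div_mul_cancel₀ _ hB.ne', hpq, mul_one]

/-- For a probability measure `μ` and bounded measurable `Y`, the map
`t ↦ t log ∫ e^{Y/t} dμ` is convex on `(0,∞)`. -/
theorem convex_t_log_int_exp {Ω : Type*} [MeasurableSpace Ω] (μ : Measure Ω)
    [IsProbabilityMeasure μ] (Y : Ω → ℝ) (hY : Measurable Y)
    (C : ℝ) (hbd : ∀ ω, |Y ω| ≤ C) :
    ConvexOn ℝ (Set.Ioi (0 : ℝ))
      (fun t : ℝ => t * Real.log (∫ ω, Real.exp (Y ω / t) ∂μ)) := by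
  have integrable_exp_div {t : ℝ} (ht : 0 < t) : Integrable (fun ω => exp (Y ω / t)) μ := by
    refine .of_bound (by fun_prop) (exp (C / t)) (.of_forall fun ω => ?_)
    rw [norm_of_nonneg (exp_pos _).le]
    gcongr
    exact (le_abs_self _).trans (hbd ω)
  refine ⟨convex_Ioi 0, fun x hx y hy a b ha hb hab => ?_⟩
  have ht : 0 < a * x + b * y := convex_Ioi 0 hx hy ha hb hab
  rw [Set.mem_Ioi] at hx hy
  simp only [smul_eq_mul]
  set t := a * x + b * y with ht_def
  have split (ω : Ω) : Y ω / t = a * x / t * (Y ω / x) + b * y / t * (Y ω / y) := by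
    field_simp
    rw [hab, mul_one]
  have h := log_integral_exp_add_le (p := a * x / t) (q := b * y / t)
    (integrable_exp_div hx) (integrable_exp_div hy) (by positivity) (by positivity)
    (by rw [← add_div, ← ht_def, div_self ht.ne'])
    (by simpa only [← split] using integrable_exp_div ht)
  simp only [← split] at h
  calc t * log (∫ ω, exp (Y ω / t) ∂μ)
      ≤ t * (a * x / t * log (∫ ω, exp (Y ω / x) ∂μ)
          + b * y / t * log (∫ ω, exp (Y ω / y) ∂μ)) := by gcongr
    _ = _ := by field_simp
end
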